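/- Let A, B, C be integers with A ≥ 1, B ≥ 1, C < 0, and let t be a real number with 0 ≤ t < 1. Then ∫₀¹ (1 − e(θ)·t^{1/2})^{−A} · (1 − e(−θ)·t^{1/2})^{−B} · e(Cθ) dθ = t^{|C|/2} · binom(A+|C|−1, |C|) · ₂F₁(B, A+|C|; |C|+1; t), where the integral is the (complex-valued) integral over the real variable θ ∈ [0,1]. -/

import Mathlib

open scoped BigOperators

/-- `e θ = exp(2πiθ)`. -/
noncomputable def e (θ : ℝ) : ℂ := Complex.exp (2 * Real.pi * Complex.I * θ)

/-- Gauss hypergeometric series `₂F₁(a,b;c;t)` for natural parameters, via rising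
factorials. -/
noncomputable def gauss2F1 (a b c : ℕ) (t : ℝ) : ℝ :=
  ∑' n : ℕ, ((Nat.ascFactorial a n : ℝ) * (Nat.ascFactorial b n : ℝ)) /
    ((Nat.ascFactorial c n : ℝ) * (Nat.factorial n : ℝ)) * t ^ n

lemma e_add (x y : ℝ) : e (x + y) = e x * e y := by
  simp only [e, ← Complex.exp_add]
  push_cast
  ring_nf

lemma e_nat_mul (n : ℕ) (x : ℝ) : e (n * x) = e x ^ n := by
  simp only [e, ← Complex.exp_nat_mul]
  push_cast
  ring_nf

lemma norm_e (x : ℝ) : ‖e x‖ = 1 := by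
  rw [e, show 2 * Real.pi * Complex.I * x = ((2 * Real.pi * x : ℝ) : ℂ) * Complex.I by
    push_cast; ring]
  exact Complex.norm_exp_ofReal_mul_I _

lemma continuous_e : Continuous e := by
  unfold e
  fun_prop

/-- Orthogonality of the characters `θ ↦ e(kθ)` on the unit interval. -/
lemma integral_e_int_mul (k : ℤ) :
    ∫ θ in (0:ℝ)..1, e (k * θ) = if k = 0 then 1 else 0 := by
  split_ifs with hk
  · simp [hk, e]
  · have hne : 2 * Real.pi * Complex.I * k ≠ 0 :=
      mul_ne_zero Complex.two_pi_I_ne_zero (Int.cast_ne_zero.mpr hk)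
    have hexp : Complex.exp (2 * Real.pi * Complex.I * k) = 1 := by
      rw [mul_comm]
      exact Complex.exp_int_mul_two_pi_mul_I k
    simp only [e]
    simp_rw [show ∀ θ : ℝ, 2 * Real.pi * Complex.I * ((k * θ : ℝ) : ℂ)
      = (2 * Real.pi * Complex.I * k) * θ by intro θ; push_cast; ring]
    rw [integral_exp_mul_complex hne]
    simp [hexp]

/-- The negative binomial series for `(1 - z) ^ (-(a + 1))`. -/
lemma hasSum_one_sub_zpow_neg (a : ℕ) {z : ℂ} (hz : ‖z‖ < 1) :
    HasSum (fun n : ℕ ↦ ((n + a).choose a : ℂ) * z ^ n)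
      ((1 - z) ^ (-((a + 1 : ℕ) : ℤ))) := by
  rw [zpow_neg, zpow_natCast, ← one_div]
  exact hasSum_choose_mul_geometric_of_norm_lt_one a hz

lemma choose_mul_choose_eq_ascFactorial (a b c n : ℕ) :
    ((n + c + a).choose a : ℝ) * (n + b).choose b =
      (a + c).choose c * (((b + 1).ascFactorial n * (a + c + 1).ascFactorial n) /
        ((c + 1).ascFactorial n * n.factorial)) := by
  have asc (m : ℕ) : ((m + 1).ascFactorial n : ℝ) = (m + n).factorial / m.factorial := by
    rw [eq_div_iff (by positivity), mul_comm]
    exact_mod_cast Nat.factorial_mul_ascFactorial m n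
  rw [asc, asc, asc, Nat.cast_choose ℝ (Nat.le_add_left c a),
    Nat.cast_choose ℝ (Nat.le_add_left a (n + c)), Nat.cast_choose ℝ (Nat.le_add_left b n),
    Nat.add_sub_cancel, Nat.add_sub_cancel, Nat.add_sub_cancel,
    show n + c + a = a + c + n by ring, add_comm n c, add_comm n b]
  field_simp

/-- The double series of Fourier modes converging to the integrand may be integrated termwise. -/
lemma hasSum_integral_modes (a b c : ℕ) {s : ℝ} (hs0 : 0 ≤ s) (hs1 : s < 1) :
    HasSum (fun p : ℕ × ℕ ↦ ∫ θ in (0:ℝ)..1,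
      ((p.1 + a).choose a : ℂ) * (e θ * s) ^ p.1 *
        (((p.2 + b).choose b : ℂ) * (e (-θ) * s) ^ p.2) * e (-(c : ℝ) * θ))
      (∫ θ in (0:ℝ)..1, (1 - e θ * s) ^ (-((a + 1 : ℕ) : ℤ)) *
        (1 - e (-θ) * s) ^ (-((b + 1 : ℕ) : ℤ)) * e (-(c : ℝ) * θ)) := by
  have hs : ‖s‖ < 1 := by rwa [Real.norm_of_nonneg hs0]
  have hz (x : ℝ) : ‖e x * s‖ = s := by simp [norm_e, abs_of_nonneg hs0]
  have hsum := (summable_choose_mul_geometric_of_norm_lt_one a hs).mul_of_nonneg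
    (summable_choose_mul_geometric_of_norm_lt_one b hs)
    (fun n ↦ by positivity) (fun n ↦ by positivity)
  have hnorm (p : ℕ × ℕ) (θ : ℝ) : ‖((p.1 + a).choose a : ℂ) * (e θ * s) ^ p.1 *
      (((p.2 + b).choose b : ℂ) * (e (-θ) * s) ^ p.2)‖ =
      ((p.1 + a).choose a : ℝ) * s ^ p.1 * (((p.2 + b).choose b : ℝ) * s ^ p.2) := by
    rw [norm_mul, norm_mul, norm_mul, norm_pow, norm_pow, hz, hz]
    simp only [Complex.norm_natCast]
  refine intervalIntegral.hasSum_integral_of_dominated_convergence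
    (fun p _ ↦ ((p.1 + a).choose a : ℝ) * s ^ p.1 * (((p.2 + b).choose b : ℝ) * s ^ p.2))
    (fun p ↦ ?_) (fun p ↦ .of_forall fun θ _ ↦ ?_) (.of_forall fun θ _ ↦ hsum)
    intervalIntegrable_const (.of_forall fun θ _ ↦ ?_)
  · have := continuous_e
    exact Continuous.aestronglyMeasurable (by fun_prop)
  · rw [norm_mul, norm_e, mul_one, hnorm]
  · have hA := hasSum_one_sub_zpow_neg a ((hz θ).trans_lt hs1)
    have hB := hasSum_one_sub_zpow_neg b ((hz (-θ)).trans_lt hs1)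
    have hAB := Summable.of_norm (hsum.congr fun p ↦ (hnorm p θ).symm)
    exact (hA.mul hB hAB).mul_right _

lemma integral_mode (a b c m n : ℕ) (s : ℝ) :
    ∫ θ in (0:ℝ)..1, ((m + a).choose a : ℂ) * (e θ * s) ^ m *
        (((n + b).choose b : ℂ) * (e (-θ) * s) ^ n) * e (-(c : ℝ) * θ) =
      if m = n + c then
        (((m + a).choose a * (n + b).choose b * s ^ (m + n) : ℝ) : ℂ) else 0 := by
  have hmode (θ : ℝ) : ((m + a).choose a : ℂ) * (e θ * s) ^ m *
      (((n + b).choose b : ℂ) * (e (-θ) * s) ^ n) * e (-(c : ℝ) * θ) =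
      (((m + a).choose a * (n + b).choose b * s ^ (m + n) : ℝ) : ℂ) *
        e (((m - n - c : ℤ) : ℝ) * θ) := by
    rw [show ((m - n - c : ℤ) : ℝ) * θ = m * θ + n * (-θ) + -(c : ℝ) * θ by push_cast; ring,
      e_add, e_add, e_nat_mul, e_nat_mul]
    push_cast
    ring
  simp_rw [hmode]
  rw [intervalIntegral.integral_const_mul, integral_e_int_mul]
  simp only [show (m - n - c : ℤ) = 0 ↔ m = n + c by omega, mul_ite, mul_one, mul_zero]

/-- the integral formula of Lemma `lemma:hyper`, case `C < 0`. -/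
theorem hyper_integral_neg (A B : ℕ) (C : ℤ) (hA : 1 ≤ A) (hB : 1 ≤ B) (hC : C < 0)
    (t : ℝ) (ht0 : 0 ≤ t) (ht1 : t < 1) :
    (∫ θ in (0:ℝ)..1,
      (1 - e θ * (Real.sqrt t : ℂ)) ^ (-(A : ℤ)) *
      (1 - e (-θ) * (Real.sqrt t : ℂ)) ^ (-(B : ℤ)) *
      e ((C : ℝ) * θ))
    = ((Real.sqrt t ^ C.natAbs : ℝ) : ℂ) *
      ((Nat.choose (A + C.natAbs - 1) C.natAbs : ℕ) : ℂ) *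
      ((gauss2F1 B (A + C.natAbs) (C.natAbs + 1) t : ℝ) : ℂ) := by
  obtain ⟨a, rfl⟩ := Nat.exists_eq_add_of_le' hA
  obtain ⟨b, rfl⟩ := Nat.exists_eq_add_of_le' hB
  obtain ⟨c, rfl⟩ : ∃ c : ℕ, C = -(c : ℤ) := ⟨C.natAbs, by omega⟩
  have hs1 : Real.sqrt t < 1 := by rwa [Real.sqrt_lt' one_pos, one_pow]
  have hinj : Function.Injective (fun n : ℕ ↦ (n + c, n)) := fun _ _ h ↦ (Prod.ext_iff.mp h).2
  have hsum := hasSum_integral_modes a b c (Real.sqrt_nonneg t) hs1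
  simp_rw [integral_mode] at hsum
  rw [← hinj.hasSum_iff] at hsum
  · simp only [Function.comp_def, if_true] at hsum
    simp only [Int.natAbs_neg, Int.natAbs_natCast, Int.cast_neg, Int.cast_natCast]
    rw [← hsum.tsum_eq, ← Complex.ofReal_tsum, gauss2F1, ← Complex.ofReal_natCast,
      ← Complex.ofReal_mul, ← Complex.ofReal_mul, ← tsum_mul_left,
      show a + 1 + c - 1 = a + c by omega, show a + 1 + c = a + c + 1 by ring]
    congr 2
    funext n
    rw [choose_mul_choose_eq_ascFactorial, show n + c + n = c + 2 * n by ring, pow_add,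
      pow_mul, Real.sq_sqrt ht0]
    ring
  · rintro ⟨m, n⟩ h
    exact if_neg fun hmn ↦ h ⟨n, Prod.ext hmn.symm rfl⟩
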